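/- arXiv:2302.04937 — 8 statements merged into one kernel-verified Lean document; each statement's English description precedes it below -/
import Mathlib

section
/- Let G be a subgroup of the symmetric group Perm(Fin 5) that is isomorphic (as a group) to the direct product S₃ × ℤ/2ℤ. Consider the induced action of G on the two-element subsets of Fin 5. Then there exists a two-element subset s of Fin 5 that is invariant under G, i.e. for every g ∈ G the image of s under g equals s. -/
set_option maxRecDepth 100000 in
/-- An element of order three in `Perm (Fin 5)` has exactly two fixed points. -/
theorem card_fixed_eq_two_of_pow_three : ∀ c : Equiv.Perm (Fin 5), c * c * c = 1 → c ≠ 1 →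
    (Finset.univ.filter fun x => c x = x).card = 2 := by
  decide

/-- `S₃ × ℤ/2ℤ` has an element of order three generating a normal subgroup. -/
theorem exists_order_three_normalized :
    ∃ c : Equiv.Perm (Fin 3) × Multiplicative (ZMod 2), c * c * c = 1 ∧ c ≠ 1 ∧
      ∀ p, p * c = c * p ∨ p * c = c * c * p := by
  refine ⟨(finRotate 3, 1), by decide, by decide, ?_⟩
  rintro ⟨σ, a⟩
  have h : ∀ σ : Equiv.Perm (Fin 3), σ * finRotate 3 = finRotate 3 * σ ∨
      σ * finRotate 3 = finRotate 3 * finRotate 3 * σ := by decide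
  simpa using h σ

/-- If `G ≤ Perm (Fin 5)` is isomorphic as a group to `S₃ × ℤ/2ℤ`, then
there is a two-element subset of `Fin 5` invariant under the induced action of `G`. -/
theorem stmt0 (G : Subgroup (Equiv.Perm (Fin 5)))
    (hG : Nonempty (G ≃* Equiv.Perm (Fin 3) × Multiplicative (ZMod 2))) :
    ∃ s : Finset (Fin 5), s.card = 2 ∧ ∀ g ∈ G, s.image ⇑g = s := by
  obtain ⟨e⟩ := hG
  obtain ⟨c₀, h3, h1, hn⟩ := exists_order_three_normalized
  obtain ⟨c, rfl⟩ := e.surjective c₀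
  simp only [← map_mul, ne_eq, map_eq_one_iff e e.injective] at h3 h1
  have hc3 : (c : Equiv.Perm (Fin 5)) * c * c = 1 := congrArg Subtype.val h3
  have hc1 : (c : Equiv.Perm (Fin 5)) ≠ 1 := fun h => h1 (Subtype.ext h)
  refine ⟨Finset.univ.filter fun x => (c : Equiv.Perm (Fin 5)) x = x,
    card_fixed_eq_two_of_pow_three c hc3 hc1, fun g hg => ?_⟩
  refine Finset.eq_of_subset_of_card_le ?_ (Finset.card_image_of_injective _ g.injective).ge
  intro y hy
  simp only [Finset.mem_image, Finset.mem_filter, Finset.mem_univ, true_and] at hy ⊢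
  obtain ⟨x, hx, rfl⟩ := hy
  have hp := hn (e ⟨g, hg⟩)
  simp only [← map_mul, e.injective.eq_iff] at hp
  rcases hp with hp | hp
  · have := DFunLike.congr_fun (congrArg Subtype.val hp) x
    simpa [hx] using this.symm
  · have h2 : g x = (c : Equiv.Perm (Fin 5)) ((c : Equiv.Perm (Fin 5)) (g x)) := by
      simpa [hx] using DFunLike.congr_fun (congrArg Subtype.val hp) x
    have h3' := DFunLike.congr_fun hc3 (g x)
    simp only [Equiv.Perm.mul_apply, Equiv.Perm.one_apply] at h3'
    rw [← h2] at h3'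
    exact h3'
end

section
/- Let G be a subgroup of the symmetric group Perm(Fin 5), acting on the two-element subsets of Fin 5 by taking images. Suppose there is no nonempty G-invariant family S of two-element subsets of Fin 5 such that any two members of S have nonempty intersection (i.e. no G-invariant independent set of vertices of the Kneser graph KG(5,2)). Then G contains an element of order 5. -/
/-- An invariant nonempty set `A` of at most two points yields the invariant intersecting family of
all pairs containing `A`. -/
theorem exists_invariant_intersecting_pairs {α : Type*} [Fintype α] [DecidableEq α]
    (hα : 2 ≤ Fintype.card α) (G : Subgroup (Equiv.Perm α)) (A : Finset α) (hA : A.Nonempty)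
    (hcard : A.card ≤ 2) (hinv : ∀ g ∈ G, ∀ a ∈ A, g a ∈ A) :
    ∃ S : Set (Finset α), S.Nonempty ∧ (∀ s ∈ S, s.card = 2) ∧
      (∀ g ∈ G, ∀ s ∈ S, s.image ⇑g ∈ S) ∧ (∀ s ∈ S, ∀ t ∈ S, (s ∩ t).Nonempty) := by
  refine ⟨{s | A ⊆ s ∧ s.card = 2}, Finset.exists_superset_card_eq hcard hα, fun s hs => hs.2,
    fun g hg s hs => ⟨fun a ha => ?_, ?_⟩, fun s hs t ht => hA.mono ?_⟩
  · exact Finset.mem_image.2 ⟨g⁻¹ a, hs.1 (hinv _ (G.inv_mem hg) a ha), by simp⟩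
  · rw [Finset.card_image_of_injective _ g.injective, hs.2]
  · exact Finset.subset_inter hs.1 ht.1

/-- If a subgroup `G ≤ Perm (Fin 5)` admits no nonempty invariant family of
pairwise intersecting two-element subsets of `Fin 5` (i.e. no invariant independent set of
vertices of the Kneser graph `KG(5,2)`), then `G` contains an element of order `5`. -/
theorem stmt1 (G : Subgroup (Equiv.Perm (Fin 5)))
    (h : ¬ ∃ S : Set (Finset (Fin 5)), S.Nonempty ∧ (∀ s ∈ S, s.card = 2) ∧
      (∀ g ∈ G, ∀ s ∈ S, s.image ⇑g ∈ S) ∧ (∀ s ∈ S, ∀ t ∈ S, (s ∩ t).Nonempty)) :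
    ∃ g ∈ G, orderOf g = 5 := by
  classical
  have hno (A : Finset (Fin 5)) (hA : A.Nonempty) (hcard : A.card ≤ 2) :
      ¬ ∀ g ∈ G, ∀ a ∈ A, g a ∈ A := fun hinv =>
    h (exists_invariant_intersecting_pairs (by simp) G A hA hcard hinv)
  set O : Finset (Fin 5) := (MulAction.orbit G (0 : Fin 5)).toFinset with hO
  have hmem (g) (hg : g ∈ G) (a : Fin 5) : g a ∈ O ↔ a ∈ O := by
    rw [hO, Set.mem_toFinset, Set.mem_toFinset, ← MulAction.orbit_eq_iff, ← MulAction.orbit_eq_iff,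
      ← MulAction.orbit_smul (⟨g, hg⟩ : G) a]
    rfl
  have hOne : O.Nonempty := ⟨0, by simp [hO]⟩
  have hcompl := Finset.card_compl O
  rw [Fintype.card_fin] at hcompl
  have hO5 : O.card = 5 := by
    by_contra hne
    have hle : O.card ≤ 5 := by simpa using O.card_le_univ
    by_cases h2 : O.card ≤ 2
    · exact hno O hOne h2 fun g hg a ha => (hmem g hg a).2 ha
    · refine hno Oᶜ (Finset.card_pos.1 (by omega)) (by omega) fun g hg a ha => ?_
      rw [Finset.mem_compl, hmem g hg a]
      exact Finset.mem_compl.1 ha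
  have hdvd : 5 ∣ Fintype.card G := by
    rw [← MulAction.card_orbit_mul_card_stabilizer_eq_card_group G (0 : Fin 5),
      ← Set.toFinset_card, ← hO, hO5]
    exact dvd_mul_right _ _
  have : Fact (Nat.Prime 5) := ⟨Nat.prime_five⟩
  obtain ⟨g, hg⟩ := exists_prime_orderOf_dvd_card 5 hdvd
  exact ⟨g, g.2, by rw [Subgroup.orderOf_coe, hg]⟩
end

section
/- Let G be a subgroup of the symmetric group Perm(Fin 5) containing no element of order 5. Then G is contained in a subgroup of Perm(Fin 5) that is isomorphic either to the symmetric group S₄ or to the direct product S₃ × ℤ/2ℤ. (Equivalently, the subgroups of Perm(Fin 5) isomorphic to S₄ and to S₃ × ℤ/2ℤ are maximal with respect to inclusion among subgroups not containing an element of order five.) -/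
open Equiv in
/-- A permutation preserving a predicate lies in the range of `Perm.subtypeCongrHom`. -/
lemma Equiv.Perm.mem_range_subtypeCongrHom {α : Type*} (p : α → Prop) [DecidablePred p]
    (g : Perm α) (hg : ∀ x, p (g x) ↔ p x) : g ∈ (Perm.subtypeCongrHom p).range := by
  refine ⟨(g.subtypePerm hg, g.subtypePerm fun x => not_congr (hg x)), ?_⟩
  ext x
  by_cases hx : p x <;> simp [Perm.subtypeCongrHom, hx]

open Equiv in
/-- The range of `Perm.subtypeCongrHom` is a product of two symmetric groups. -/
lemma Equiv.Perm.nonempty_range_subtypeCongrHom_mulEquiv {α : Type*} [Finite α] (p : α → Prop)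
    [DecidablePred p] {m n : ℕ} (hm : Nat.card {x // p x} = m) (hn : Nat.card {x // ¬ p x} = n) :
    Nonempty ((Perm.subtypeCongrHom p).range ≃* Perm (Fin m) × Perm (Fin n)) :=
  ⟨(MonoidHom.ofInjective (Perm.subtypeCongrHom_injective p)).symm.trans
    (MulEquiv.prodCongr (Finite.equivFinOfCardEq hm).permCongrHom
      (Finite.equivFinOfCardEq hn).permCongrHom)⟩

/-- A group of permutations of a finite set with `p` elements, `p` prime, which contains no element
of order `p` is not transitive. -/
lemma Subgroup.card_orbit_ne_of_forall_orderOf_ne {α : Type*} [Finite α]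
    (G : Subgroup (Equiv.Perm α)) {p : ℕ} [Fact p.Prime] (h : ∀ g ∈ G, orderOf g ≠ p) (a : α) :
    Nat.card (MulAction.orbit G a) ≠ p := by
  intro hc
  have hd : p ∣ Nat.card G := by
    rw [← hc, Nat.card_congr (MulAction.orbitEquivQuotientStabilizer G a)]
    exact Subgroup.card_quotient_dvd_card _
  obtain ⟨g, hg⟩ := exists_prime_orderOf_dvd_card' p hd
  exact h g g.2 (by rw [Subgroup.orderOf_coe, hg])

/-- Every subgroup of `Perm (Fin 5)` with no element of order `5` is contained
in a subgroup isomorphic to `S₄` or to `S₃ × ℤ/2ℤ`. -/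
theorem stmt2 (G : Subgroup (Equiv.Perm (Fin 5))) (h : ∀ g ∈ G, orderOf g ≠ 5) :
    ∃ M : Subgroup (Equiv.Perm (Fin 5)), G ≤ M ∧
      (Nonempty (M ≃* Equiv.Perm (Fin 4)) ∨
        Nonempty (M ≃* Equiv.Perm (Fin 3) × Multiplicative (ZMod 2))) := by
  classical
  have : Fact (Nat.Prime 5) := ⟨by norm_num⟩
  let p : Fin 5 → Prop := fun x => x ∈ MulAction.orbit G (0 : Fin 5)
  have hne : Nat.card {x // p x} ≠ 5 := G.card_orbit_ne_of_forall_orderOf_ne h 0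
  have hpos : 0 < Nat.card {x // p x} :=
    haveI : Nonempty {x // p x} := ⟨0, MulAction.mem_orbit_self 0⟩
    Nat.card_pos
  have hsum : Nat.card {x // p x} + Nat.card {x // ¬ p x} = 5 := by
    rw [← Nat.card_sum, Nat.card_congr (Equiv.sumCompl p), Nat.card_fin]
  refine ⟨(Equiv.Perm.subtypeCongrHom p).range, fun g hg =>
    Equiv.Perm.mem_range_subtypeCongrHom p g fun x => ?_, ?_⟩
  · change (⟨g, hg⟩ : G) • x ∈ MulAction.orbit G 0 ↔ x ∈ MulAction.orbit G 0
    rw [← MulAction.orbit_eq_iff, MulAction.orbit_smul, MulAction.orbit_eq_iff]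
  have e₂ : Equiv.Perm (Fin 2) ≃* Multiplicative (ZMod 2) :=
    haveI : Fact (Nat.Prime 2) := ⟨Nat.prime_two⟩
    mulEquivOfPrimeCardEq (p := 2) (by simp [Fintype.card_perm]) (by simp)
  have hcases : Nat.card {x // p x} = 1 ∧ Nat.card {x // ¬ p x} = 4 ∨
      Nat.card {x // p x} = 2 ∧ Nat.card {x // ¬ p x} = 3 ∨
      Nat.card {x // p x} = 3 ∧ Nat.card {x // ¬ p x} = 2 ∨
      Nat.card {x // p x} = 4 ∧ Nat.card {x // ¬ p x} = 1 := by omega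
  rcases hcases with ⟨h₁, h₂⟩ | ⟨h₁, h₂⟩ | ⟨h₁, h₂⟩ | ⟨h₁, h₂⟩ <;>
    obtain ⟨e⟩ := Equiv.Perm.nonempty_range_subtypeCongrHom_mulEquiv p h₁ h₂
  · exact .inl ⟨e.trans MulEquiv.uniqueProd⟩
  · exact .inr ⟨(e.trans MulEquiv.prodComm).trans ((MulEquiv.refl _).prodCongr e₂)⟩
  · exact .inr ⟨e.trans ((MulEquiv.refl _).prodCongr e₂)⟩
  · exact .inl ⟨e.trans MulEquiv.prodUnique⟩
end

section
/- Let n be a natural number with n ≥ 1, let G be a finite group acting transitively on Fin n, and let L ⊃ K be a finite Galois field extension together with a group isomorphism φ : Gal(L/K) ≃ G. Let H ≤ Gal(L/K) be the preimage under φ of the stabilizer in G of 0 ∈ Fin n, and let M = L^H. Then there exists an injective map β : Fin n → L such that: (1) M = K(β 0), i.e. β 0 generates M over K; (2) the range of β is exactly the set of roots in L of the minimal polynomial of β 0 over K; and (3) for every σ ∈ Gal(L/K) and every i ∈ Fin n, σ(β i) = β((φ σ) • i). -/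
/-- In a finite separable extension, every intermediate field is generated by one element. -/
theorem IntermediateField.exists_adjoin_singleton_eq {K L : Type*} [Field K] [Field L]
    [Algebra K L] [FiniteDimensional K L] [Algebra.IsSeparable K L]
    (M : IntermediateField K L) : ∃ a : L, IntermediateField.adjoin K {a} = M := by
  obtain ⟨α, hα⟩ := Field.exists_primitive_element K M
  refine ⟨α, ?_⟩
  have h := congrArg IntermediateField.lift hα
  rwa [IntermediateField.lift_adjoin_simple, IntermediateField.lift_top] at h

/-- An automorphism fixes `a` exactly when it fixes the field generated by `a`. -/
theorem IntermediateField.mem_fixingSubgroup_adjoin_singleton_iff {K L : Type*} [Field K] [Field L]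
    [Algebra K L] (a : L) (σ : L ≃ₐ[K] L) :
    σ ∈ (IntermediateField.adjoin K {a}).fixingSubgroup ↔ σ a = a := by
  rw [← Subgroup.zpowers_le, ← IntermediateField.le_iff_le, IntermediateField.adjoin_simple_le_iff,
    IntermediateField.mem_fixedField_iff]
  refine ⟨fun h => h σ (Subgroup.mem_zpowers σ), fun h τ hτ => ?_⟩
  have hle : Subgroup.zpowers σ ≤ MulAction.stabilizer (L ≃ₐ[K] L) a :=
    Subgroup.zpowers_le.2 h
  exact hle hτ

/-- In the setting of Lemma 5.1 of the paper: `G` a finite group acting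
transitively on `Fin n` (`n ≥ 1`), `L/K` a finite Galois extension with
`φ : Gal(L/K) ≃* G`, `H` the preimage under `φ` of the stabilizer of `0 : Fin n`, and
`M = Lᴴ`. Then there is an injective `β : Fin n → L` such that `M = K(β 0)`, the range of
`β` is exactly the set of roots in `L` of the minimal polynomial of `β 0` over `K`, and
`σ (β i) = β (φ σ • i)` for all `σ ∈ Gal(L/K)` and all `i`. -/
theorem stmt4 (n : ℕ) (hn : 1 ≤ n) (G : Type*) [Group G] [Finite G]
    [MulAction G (Fin n)] [MulAction.IsPretransitive G (Fin n)]
    (K L : Type*) [Field K] [Field L] [Algebra K L] [FiniteDimensional K L] [IsGalois K L]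
    (φ : (L ≃ₐ[K] L) ≃* G)
    (H : Subgroup (L ≃ₐ[K] L))
    (hH : H = (MulAction.stabilizer G (⟨0, hn⟩ : Fin n)).comap φ.toMonoidHom)
    (M : IntermediateField K L) (hM : M = IntermediateField.fixedField H) :
    ∃ β : Fin n → L, Function.Injective β ∧
      IntermediateField.adjoin K {β ⟨0, hn⟩} = M ∧
      Set.range β = {x : L | Polynomial.aeval x (minpoly K (β ⟨0, hn⟩)) = 0} ∧
      ∀ (σ : L ≃ₐ[K] L) (i : Fin n), σ (β i) = β (φ σ • i) := by
  obtain ⟨a, ha⟩ := M.exists_adjoin_singleton_eq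
  have fix (σ : L ≃ₐ[K] L) : σ a = a ↔ φ σ • (⟨0, hn⟩ : Fin n) = ⟨0, hn⟩ := by
    rw [← IntermediateField.mem_fixingSubgroup_adjoin_singleton_iff, ha, hM,
      IntermediateField.fixingSubgroup_fixedField, hH]
    rfl
  have eq_iff (σ τ : L ≃ₐ[K] L) :
      σ a = τ a ↔ φ σ • (⟨0, hn⟩ : Fin n) = φ τ • (⟨0, hn⟩ : Fin n) := by
    have h := fix (τ⁻¹ * σ)
    rw [map_mul, map_inv, mul_smul, inv_smul_eq_iff] at h
    rw [← h, AlgEquiv.mul_apply, AlgEquiv.aut_inv, AlgEquiv.symm_apply_eq]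
  have lift (i : Fin n) : ∃ σ : L ≃ₐ[K] L, φ σ • (⟨0, hn⟩ : Fin n) = i := by
    obtain ⟨g, hg⟩ := MulAction.exists_smul_eq G (⟨0, hn⟩ : Fin n) i
    exact ⟨φ.symm g, by simpa using hg⟩
  choose s hs using lift
  have apply_smul (σ : L ≃ₐ[K] L) : s (φ σ • ⟨0, hn⟩) a = σ a := (eq_iff _ _).2 (hs _)
  have base : s ⟨0, hn⟩ a = a := (fix _).2 (hs _)
  refine ⟨fun i => s i a, fun i j hij => ?_, ?_, ?_, fun σ i => ?_⟩
  · rw [← hs i, ← hs j]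
    exact (eq_iff _ _).1 hij
  · simpa only [base] using ha
  · simp only [base]
    ext x
    constructor
    · rintro ⟨i, rfl⟩
      change Polynomial.aeval (s i a) (minpoly K a) = 0
      rw [← minpoly.algEquiv_eq (s i) a, minpoly.aeval]
    · intro hx
      obtain ⟨σ, hσ⟩ := minpoly.exists_algEquiv_of_root' (Algebra.IsAlgebraic.isAlgebraic a) hx
      exact ⟨φ σ • ⟨0, hn⟩, (apply_smul σ).trans hσ⟩
  · change (σ * s i) a = s (φ σ • i) a
    rw [eq_iff, hs, map_mul, mul_smul, hs]
end

section
/- Let n and k be natural numbers and let G be a subgroup of Perm(Fin n) whose complexity equals k, where the complexity c(G) is the maximum, over all cardinalities m, of the number of orbits of cardinality m for the action of G on Fin n. Let K be a field with at least k + 1 elements, and let L ⊃ K be a finite Galois extension with a group isomorphism φ : Gal(L/K) ≃ G. Then there exists an injective map β : Fin n → L such that for every σ ∈ Gal(L/K) and every i ∈ Fin n, σ(β i) = β((φ σ) i). -/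
/-- The number of orbits of cardinality `m` for the action of a subgroup
`G ≤ Perm (Fin n)` on `Fin n`. -/
noncomputable def orbitCount (n : ℕ) (G : Subgroup (Equiv.Perm (Fin n))) (m : ℕ) : ℕ :=
  Set.ncard {ω : Set (Fin n) | (∃ i : Fin n, ω = MulAction.orbit G i) ∧ ω.ncard = m}

/-- The complexity `c(G)` of a subgroup `G ≤ Perm (Fin n)`: the maximal number of orbits
of equal cardinality in the orbit decomposition of `Fin n` under `G`. -/
noncomputable def complexity (n : ℕ) (G : Subgroup (Equiv.Perm (Fin n))) : ℕ :=
  sSup (Set.range (orbitCount n G))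

theorem orbitCount_le_complexity (n : ℕ) (G : Subgroup (Equiv.Perm (Fin n))) (m : ℕ) :
    orbitCount n G m ≤ complexity n G := by
  refine le_csSup ⟨Nat.card (Set (Fin n)), ?_⟩ ⟨m, rfl⟩
  rintro _ ⟨l, rfl⟩
  exact Set.ncard_le_card _

/-- A finite set with at most `k` elements injects into the nonzero elements of a field with
more than `k` elements. -/
theorem exists_injOn_ne_zero {α K : Type*} [Field K] {k : ℕ}
    (hK : (k + 1 : Cardinal) ≤ Cardinal.mk K) {S : Set α} (hS : S.Finite) (hk : S.ncard ≤ k) :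
    ∃ f : α → K, Set.InjOn f S ∧ ∀ a, f a ≠ 0 := by
  classical
  have hK' : ((k + 1 : ℕ) : Cardinal) ≤ Cardinal.mk K := by exact_mod_cast hK
  obtain ⟨t, ht⟩ := Cardinal.exists_finset_eq_card hK'
  have := hS.fintype
  have hcard : Fintype.card S ≤ Fintype.card (t.erase 0 : Finset K) := by
    rw [Fintype.card_coe, ← Nat.card_eq_fintype_card, Nat.card_coe_set_eq]
    have := Finset.pred_card_le_card_erase (s := t) (a := (0 : K))
    omega
  obtain ⟨e⟩ := Function.Embedding.nonempty_of_card_le hcard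
  refine ⟨fun a => if h : a ∈ S then (e ⟨a, h⟩ : K) else 1, fun a ha b hb hab => ?_, fun a => ?_⟩
  · simp only [dif_pos ha, dif_pos hb] at hab
    exact congrArg Subtype.val (e.injective (Subtype.ext hab))
  · by_cases h : a ∈ S
    · simpa only [dif_pos h] using Finset.ne_of_mem_erase (e ⟨a, h⟩).2
    · simp only [dif_neg h]
      exact one_ne_zero

/-- Two points have equal stabilizers as soon as one nonempty fibre of the orbit map of the first
is a fibre of the orbit map of the second. -/
theorem stabilizer_eq_of_forall_smul_eq_iff {G X : Type*} [Group G] [MulAction G X]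
    {r s i j : X} (h : ∀ g : G, g • r = i ↔ g • s = j) {g₀ : G} (hg₀ : g₀ • r = i) :
    MulAction.stabilizer G r = MulAction.stabilizer G s := by
  have hs := (h g₀).1 hg₀
  ext g
  have hg := h (g₀ * g)
  rw [mul_smul, mul_smul, ← hg₀, ← hs, smul_left_cancel_iff, smul_left_cancel_iff] at hg
  exact hg

/-- If `G ≤ Perm (Fin n)` has complexity `k`, the field `K` has at least
`k + 1` elements, and `L/K` is a finite Galois extension with `φ : Gal(L/K) ≃* G`, then
there is an injective `β : Fin n → L` with `σ (β i) = β ((φ σ) i)` for all `σ, i`. -/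
theorem stmt5 (n k : ℕ) (G : Subgroup (Equiv.Perm (Fin n))) (hG : complexity n G = k)
    (K L : Type*) [Field K] [Field L] [Algebra K L] [FiniteDimensional K L] [IsGalois K L]
    (hK : (k + 1 : Cardinal) ≤ Cardinal.mk K)
    (φ : (L ≃ₐ[K] L) ≃* G) :
    ∃ β : Fin n → L, Function.Injective β ∧
      ∀ (σ : L ≃ₐ[K] L) (i : Fin n), σ (β i) = β (((φ σ : G) : Equiv.Perm (Fin n)) i) := by
  classical
  have hcount : ∀ m, orbitCount n G m ≤ k := fun m => hG ▸ orbitCount_le_complexity n G m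
  choose f hf hf0 using fun m => exists_injOn_ne_zero hK (Set.toFinite _) (hcount m)
  let c : Fin n → K := fun i => f (MulAction.orbit G i).ncard (MulAction.orbit G i)
  let r : Fin n → Fin n := fun i => (Quotient.mk (MulAction.orbitRel G (Fin n)) i).out
  have hr : ∀ i, MulAction.orbit G (r i) = MulAction.orbit G i := fun i =>
    MulAction.orbit_eq_iff.2 (Quotient.mk_out (s := MulAction.orbitRel G (Fin n)) i)
  have hr_congr : ∀ {i j}, MulAction.orbit G i = MulAction.orbit G j → r i = r j := fun h =>
    congrArg Quotient.out (Quotient.sound (MulAction.orbit_eq_iff.1 h))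
  have horbit : ∀ (g : G) (i : Fin n), MulAction.orbit G (g • i) = MulAction.orbit G i := fun g i =>
    MulAction.orbit_smul g i
  let b := (IsGalois.normalBasis K L).reindex φ.toEquiv
  have hb : ∀ (σ : L ≃ₐ[K] L) (g : G), σ (b g) = b (φ σ * g) := fun σ g => by
    simp only [b, Module.Basis.reindex_apply]
    rw [IsGalois.normalBasis_apply, IsGalois.normalBasis_apply (φ.toEquiv.symm (φ σ * g))]
    have : φ.toEquiv.symm (φ σ * g) = σ * φ.toEquiv.symm g := by
      change φ.symm (φ σ * g) = σ * φ.symm g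
      rw [map_mul, φ.symm_apply_apply]
    rw [this, AlgEquiv.mul_apply]
  refine ⟨fun i => b.equivFun.symm fun g => if g • r i = i then c i else 0, fun i j hij => ?_,
    fun σ i => ?_⟩
  · have hcoef : ∀ g : G, (if g • r i = i then c i else 0) = if g • r j = j then c j else 0 :=
      congrFun (b.equivFun.symm.injective hij)
    have hiff : ∀ g : G, g • r i = i ↔ g • r j = j := fun g => by
      have := hcoef g
      have hi : c i ≠ 0 := hf0 _ _
      have hj : c j ≠ 0 := hf0 _ _
      split_ifs at this <;> simp_all
    obtain ⟨g, hg⟩ : i ∈ MulAction.orbit G (r i) := hr i ▸ MulAction.mem_orbit_self i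
    replace hg : g • r i = i := hg
    have hg' := (hiff g).1 hg
    have hc : c i = c j := by simpa only [if_pos hg, if_pos hg'] using hcoef g
    have hcard : (MulAction.orbit G i).ncard = (MulAction.orbit G j).ncard := by
      rw [← hr i, ← hr j, ← MulAction.index_stabilizer, ← MulAction.index_stabilizer,
        stabilizer_eq_of_forall_smul_eq_iff hiff hg]
    have heq : MulAction.orbit G i = MulAction.orbit G j :=
      hf _ ⟨⟨i, rfl⟩, rfl⟩ ⟨⟨j, rfl⟩, hcard.symm⟩ (by simpa only [c, ← hcard] using hc)
    rw [← hg, hr_congr heq, hg']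
  · change _ = b.equivFun.symm fun g => if g • r (φ σ • i) = φ σ • i then c (φ σ • i) else 0
    have hc : c (φ σ • i) = c i := by simp only [c, horbit]
    rw [hr_congr (horbit (φ σ) i), hc]
    simp only [Module.Basis.equivFun_symm_apply, map_sum]
    refine (Finset.sum_congr rfl fun g _ => ?_).trans (Equiv.sum_comp (Equiv.mulLeft (φ σ)) _)
    simp only [map_smul, hb, Equiv.coe_mulLeft, mul_smul, smul_left_cancel_iff]
end

section
/- Let n and k be natural numbers and let G be a subgroup of Perm(Fin n) whose complexity equals k, where the complexity c(G) is the maximum, over all cardinalities m, of the number of orbits of cardinality m for the action of G on Fin n. Let K be a field with at least k + 1 elements and let K^sep be a separable closure of K. If there exists a finite Galois extension L ⊃ K with Galois group isomorphic to G, then there exist an injective map β : Fin n → K^sep and a group homomorphism ρ : Gal(K^sep/K) → Perm(Fin n) whose range is exactly G, such that for every σ ∈ Gal(K^sep/K) and every i ∈ Fin n, σ(β i) = β((ρ σ) i). In particular, the set {β i : i ∈ Fin n} is invariant under Gal(K^sep/K) and the induced action of Gal(K^sep/K) on it is equivalent to the action of G on Fin n. -/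
open MulAction in
theorem ncard_orbit_eq_of_stabilizer_eq {G X : Type*} [Group G] [MulAction G X] {x y : X}
    (h : stabilizer G x = stabilizer G y) : (orbit G x).ncard = (orbit G y).ncard := by
  have e : orbit G x ≃ orbit G y :=
    (orbitEquivQuotientStabilizer G x).trans
      ((Subgroup.quotientEquivOfEq h).trans (orbitEquivQuotientStabilizer G y).symm)
  exact Nat.card_congr e

open MulAction in
theorem ncard_orbit_eq_of_smul_eq_iff {G X : Type*} [Group G] [MulAction G X] {r s x y : X}
    (hr : r ∈ orbit G x) (hs : s ∈ orbit G y) (h : ∀ g : G, g • r = x ↔ g • s = y) :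
    (orbit G x).ncard = (orbit G y).ncard := by
  rw [← orbit_eq_iff.mpr hr, ← orbit_eq_iff.mpr hs]
  apply ncard_orbit_eq_of_stabilizer_eq
  obtain ⟨g, hg⟩ := mem_orbit_symm.mp hr
  have hg' := (h g).mp hg
  ext u
  have := h (g * u)
  simp only [mul_smul, ← hg, ← hg', smul_left_cancel_iff] at this
  simpa [mem_stabilizer_iff, hg] using this

open MulAction in
/-- If the orbits of equal cardinality of a `G`-set `X` can be told apart by nonzero labels in `K`,
then `X` embeds equivariantly into any finite Galois extension of `K` with group `G`. -/
theorem exists_equivariant_injective_of_label {G X K L : Type*} [Group G] [MulAction G X]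
    [Field K] [Field L] [Algebra K L] [FiniteDimensional K L] [IsGalois K L]
    (φ : (L ≃ₐ[K] L) ≃* G) (c : Set X → K) (hc : ∀ x : X, c (orbit G x) ≠ 0)
    (hinj : ∀ x y : X, (orbit G x).ncard = (orbit G y).ncard →
      c (orbit G x) = c (orbit G y) → orbit G x = orbit G y) :
    ∃ β : X → L, Function.Injective β ∧ ∀ (σ : L ≃ₐ[K] L) (x : X), σ (β x) = β (φ σ • x) := by
  classical
  obtain ⟨r, hr, hrc⟩ : ∃ r : X → X, (∀ x, r x ∈ orbit G x) ∧
      ∀ x y, orbit G x = orbit G y → r x = r y :=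
    ⟨fun x => (Quotient.mk (orbitRel G X) x).out,
      fun x => orbitRel_apply.mp (Quotient.mk_out (s := orbitRel G X) x),
      fun x y h => congrArg Quotient.out (Quotient.sound (s := orbitRel G X)
        (orbitRel_apply.mpr (orbit_eq_iff.mp h)))⟩
  let b := IsGalois.normalBasis K L
  let coef (x : X) (σ : L ≃ₐ[K] L) : K := if φ σ • r x = x then c (orbit G x) else 0
  refine ⟨fun x => ∑ σ, coef x σ • b σ, fun x y hxy => ?_, fun τ x => ?_⟩
  · have hcoef : ∀ σ, coef x σ = coef y σ := fun σ => by
      have := congrArg (fun z => b.repr z σ) hxy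
      simpa only [Module.Basis.repr_sum_self] using this
    have hiff : ∀ g : G, g • r x = x ↔ g • r y = y := fun g => by
      have := hcoef (φ.symm g)
      simp only [coef, MulEquiv.apply_symm_apply] at this
      have hx := hc x
      have hy := hc y
      clear hc
      by_cases h₁ : g • r x = x <;> by_cases h₂ : g • r y = y <;> simp_all
    obtain ⟨g, hg⟩ := mem_orbit_symm.mp (hr x)
    have hg₁ : g • r x = x := hg
    have hg₂ := (hiff g).mp hg₁
    have hlabel := hcoef (φ.symm g)
    simp only [coef, MulEquiv.apply_symm_apply, if_pos hg₁, if_pos hg₂] at hlabel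
    have horbit := hinj x y (ncard_orbit_eq_of_smul_eq_iff (hr x) (hr y) hiff) hlabel
    rw [← hg₁, ← hg₂, hrc x y horbit]
  · have hb : ∀ σ, τ (b σ) = b (τ * σ) := fun σ => by
      simp only [b]
      rw [IsGalois.normalBasis_apply σ, IsGalois.normalBasis_apply (τ * σ), AlgEquiv.mul_apply]
    simp only [map_sum, map_smul, hb]
    refine Fintype.sum_equiv (Equiv.mulLeft τ) _ _ fun σ => ?_
    have horb : orbit G (φ τ • x) = orbit G x := orbit_smul _ _
    simp only [coef, Equiv.coe_mulLeft, map_mul, mul_smul, horb, hrc _ _ horb,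
      smul_left_cancel_iff]

/-- A field with more than `k` elements supplies nonzero labels telling apart the members of equal
cardinality in any family of sets with at most `k` members of each cardinality. -/
theorem exists_nonzero_label {X K : Type*} [Finite X] [Field K] {k : ℕ}
    (hK : (k + 1 : Cardinal) ≤ Cardinal.mk K) (S : Set (Set X))
    (hS : ∀ m, {ω | ω ∈ S ∧ ω.ncard = m}.ncard ≤ k) :
    ∃ c : Set X → K, (∀ ω ∈ S, c ω ≠ 0) ∧
      ∀ ω ∈ S, ∀ ω' ∈ S, ω.ncard = ω'.ncard → c ω = c ω' → ω = ω' := by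
  classical
  have hunits : (k : Cardinal) ≤ Cardinal.mk ({0}ᶜ : Set K) := by
    rw [← Cardinal.mk_sum_compl ({0} : Set K), Cardinal.mk_singleton,
      add_comm 1] at hK
    exact Cardinal.add_one_le_add_one_iff.mp hK
  have hemb : ∀ m, Nonempty ({ω | ω ∈ S ∧ ω.ncard = m} ↪ ({0}ᶜ : Set K)) := fun m => by
    rw [← Cardinal.lift_mk_le', ← Set.cast_ncard (Set.toFinite _), Cardinal.lift_natCast]
    refine (Nat.cast_le.mpr (hS m)).trans ?_
    exact Cardinal.nat_le_lift_iff.mpr hunits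
  let f m := (hemb m).some
  refine ⟨fun ω => if h : ω ∈ S then f ω.ncard ⟨ω, h, rfl⟩ else 0, fun ω h => ?_,
    fun ω h ω' h' hcard heq => ?_⟩
  · simpa only [dif_pos h, Set.mem_compl_iff, Set.mem_singleton_iff] using! (f ω.ncard ⟨ω, h, rfl⟩).2
  · have hlabel : ∀ m (hm : ω'.ncard = m), (f ω'.ncard ⟨ω', h', rfl⟩ : K) = f m ⟨ω', h', hm⟩ := by
      rintro _ rfl
      rfl
    simp only [dif_pos h, dif_pos h', hlabel _ hcard.symm] at heq
    exact congrArg Subtype.val ((f ω.ncard).injective (Subtype.ext heq))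

/-- If `G ≤ Perm (Fin n)` has complexity `k`, the field `K` has at least
`k + 1` elements, `Ksep` is a separable closure of `K`, and there exists a finite Galois
extension `L/K` with Galois group isomorphic to `G`, then there exist an injective
`β : Fin n → Ksep` and a homomorphism `ρ : Gal(Ksep/K) →* Perm (Fin n)` with range exactly
`G` such that `σ (β i) = β (ρ σ i)` for all `σ, i`; in particular the set
`{β i : i ∈ Fin n}` is `Gal(Ksep/K)`-invariant and the induced action on it is equivalent
to the action of `G` on `Fin n`. -/
theorem stmt6 (n k : ℕ) (G : Subgroup (Equiv.Perm (Fin n))) (hG : complexity n G = k)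
    (K Ksep : Type*) [Field K] [Field Ksep] [Algebra K Ksep] [IsSepClosure K Ksep]
    (hK : (k + 1 : Cardinal) ≤ Cardinal.mk K)
    (L : Type*) [Field L] [Algebra K L] [FiniteDimensional K L] [IsGalois K L]
    (φ : (L ≃ₐ[K] L) ≃* G) :
    ∃ (β : Fin n → Ksep) (ρ : (Ksep ≃ₐ[K] Ksep) →* Equiv.Perm (Fin n)),
      Function.Injective β ∧ ρ.range = G ∧
      ∀ (σ : Ksep ≃ₐ[K] Ksep) (i : Fin n), σ (β i) = β (ρ σ i) := by
  obtain ⟨c, hc, hinj⟩ := exists_nonzero_label (X := Fin n) hK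
    {ω | ∃ i : Fin n, ω = MulAction.orbit G i}
    fun m => (orbitCount_le_complexity n G m).trans hG.le
  obtain ⟨β, hβ, hequiv⟩ := exists_equivariant_injective_of_label φ c (fun i => hc _ ⟨i, rfl⟩)
    fun i j => hinj _ ⟨i, rfl⟩ _ ⟨j, rfl⟩
  have : IsSepClosed Ksep := IsSepClosure.sep_closed K
  let ι : L →ₐ[K] Ksep := IsSepClosed.lift
  let _ : Algebra L Ksep := ι.toRingHom.toAlgebra
  have : IsScalarTower K L Ksep := IsScalarTower.of_algebraMap_eq fun x => (ι.commutes x).symm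
  refine ⟨fun i => algebraMap L Ksep (β i),
    G.subtype.comp (φ.toMonoidHom.comp (AlgEquiv.restrictNormalHom L)),
    (algebraMap L Ksep).injective.comp hβ, ?_, fun σ i => ?_⟩
  · rw [MonoidHom.range_comp, MonoidHom.range_eq_top.mpr, ← MonoidHom.range_eq_map,
      Subgroup.range_subtype]
    exact φ.surjective.comp (AlgEquiv.restrictNormalHom_surjective Ksep)
  · rw [← AlgEquiv.restrictNormal_commutes]
    exact congrArg (algebraMap L Ksep) (hequiv (σ.restrictNormal L) i)
end

section
/- Let V be a vector space over ℚ of dimension 5 and let ρ be a representation of the cyclic group ℤ/5ℤ on V (a group homomorphism ℤ/5ℤ → GL(V)). If ρ is not the trivial representation, then the subspace of invariants {v ∈ V | ρ(g) v = v for all g ∈ ℤ/5ℤ} has dimension exactly 1. -/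
/-- The dimension of a vector space on which an extension field acts linearly is a multiple of
the degree of the extension. -/
theorem finrank_dvd_finrank_of_algHom {F K W : Type*} [Field F] [Field K] [Algebra F K]
    [AddCommGroup W] [Module F W] (f : K →ₐ[F] Module.End F W) :
    Module.finrank F K ∣ Module.finrank F W := by
  let : Module K W := Module.compHom W f.toRingHom
  have : IsScalarTower F K W := IsScalarTower.of_algebraMap_smul fun r x => by
    change f (algebraMap F K r) x = r • x
    rw [AlgHom.commutes, Module.algebraMap_end_apply]
  exact ⟨_, (Module.finrank_mul_finrank F K W).symm⟩

open Polynomial in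
/-- The kernel of an irreducible polynomial in an endomorphism has dimension divisible by the
degree of the polynomial. -/
theorem natDegree_dvd_finrank_ker_aeval {F V : Type*} [Field F] [AddCommGroup V] [Module F V]
    (T : Module.End F V) {p : F[X]} (hp : Irreducible p) :
    p.natDegree ∣ Module.finrank F (LinearMap.ker (aeval T p)) := by
  have : Fact (Irreducible p) := ⟨hp⟩
  have hT : ∀ x ∈ LinearMap.ker (aeval T p), T x ∈ LinearMap.ker (aeval T p) := by
    intro x hx
    have hc : aeval T p * T = T * aeval T p := by
      simpa using congrArg (aeval T) (mul_comm p X)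
    have h := LinearMap.congr_fun hc x
    rw [LinearMap.mem_ker] at hx ⊢
    rw [Module.End.mul_apply, Module.End.mul_apply, hx, map_zero] at h
    exact h
  have hS : aeval (T.restrict hT) p = 0 := by
    ext x
    have h : ∀ q : F[X], ((aeval (T.restrict hT) q x : LinearMap.ker (aeval T p)) : V) =
        aeval T q x := by
      intro q
      induction q using Polynomial.induction_on generalizing x with
      | C a => simp [Module.algebraMap_end_apply]
      | add q r hq hr => simp [hq, hr]
      | monomial n a ih =>
        rw [pow_succ, ← mul_assoc, map_mul _ _ X, map_mul _ _ X, Module.End.mul_apply,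
          Module.End.mul_apply, aeval_X, aeval_X, ih]
        rfl
    rw [h]
    exact x.2
  have hker : ∀ q ∈ Ideal.span {p}, aeval (T.restrict hT) q = 0 := by
    intro q hq
    obtain ⟨r, rfl⟩ := Ideal.mem_span_singleton.mp hq
    rw [map_mul, hS, zero_mul]
  let f : AdjoinRoot p →ₐ[F] Module.End F (LinearMap.ker (aeval T p)) :=
    Ideal.Quotient.liftₐ (Ideal.span {p}) (aeval (T.restrict hT)) hker
  have h := finrank_dvd_finrank_of_algHom f
  rwa [(AdjoinRoot.powerBasis hp.ne_zero).finrank, AdjoinRoot.powerBasis_dim] at h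

open Polynomial in
/-- A nontrivial representation of `ℤ/5ℤ` on a 5-dimensional `ℚ`-vector
space has a 1-dimensional subspace of invariants. -/
theorem stmt8 (V : Type*) [AddCommGroup V] [Module ℚ V] (hV : Module.finrank ℚ V = 5)
    (ρ : Representation ℚ (Multiplicative (ZMod 5)) V)
    (hρ : ¬ ∀ g, ρ g = LinearMap.id) :
    Module.finrank ℚ ρ.invariants = 1 := by
  have : FiniteDimensional ℚ V := Module.finite_of_finrank_pos (by omega)
  set g : Multiplicative (ZMod 5) := Multiplicative.ofAdd 1
  have hg : ∀ x, x ∈ Subgroup.zpowers g := by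
    intro x
    refine ⟨(x.toAdd.val : ℤ), ?_⟩
    apply Multiplicative.toAdd.injective
    simp [g]
  have hg5 : g ^ 5 = 1 := by
    change (Multiplicative.ofAdd 1 : Multiplicative (ZMod 5)) ^ 5 = 1
    decide
  have : Fact (Nat.Prime 5) := ⟨by norm_num⟩
  have hirr : Irreducible (cyclotomic 5 ℚ) := cyclotomic.irreducible_rat (by norm_num)
  have hprod : (X - 1 : ℚ[X]) * cyclotomic 5 ℚ = X ^ 5 - 1 := by
    rw [mul_comm, cyclotomic_prime_mul_X_sub_one]
  have hinv : ρ.invariants = LinearMap.ker (aeval (ρ g) (X - 1 : ℚ[X])) := by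
    ext x
    rw [ρ.mem_invariants_iff_of_forall_mem_zpowers g hg x]
    simp [sub_eq_zero]
  have hcop : IsCoprime (X - 1 : ℚ[X]) (cyclotomic 5 ℚ) := by
    rw [← cyclotomic_one]
    exact cyclotomic.isCoprime_rat (by norm_num)
  have hsup := sup_ker_aeval_eq_ker_aeval_mul_of_coprime (ρ g) hcop
  have hdis := (disjoint_ker_aeval_of_isCoprime (ρ g) hcop)
  have htop : LinearMap.ker (aeval (ρ g) ((X - 1 : ℚ[X]) * cyclotomic 5 ℚ)) = ⊤ := by
    rw [hprod, LinearMap.ker_eq_top]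
    rw [map_sub, map_pow, aeval_X, map_one, ← map_pow, hg5, map_one, sub_self]
  rw [htop, ← hinv] at hsup
  rw [← hinv] at hdis
  have hadd := Submodule.finrank_add_eq_of_isCompl ⟨hdis, codisjoint_iff.mpr hsup⟩
  have hdvd := natDegree_dvd_finrank_ker_aeval (ρ g) hirr
  rw [natDegree_cyclotomic, Nat.totient_prime Fact.out] at hdvd
  have hlt : Module.finrank ℚ ρ.invariants ≠ 5 := by
    intro h
    have htriv : ρ.invariants = ⊤ := Submodule.eq_top_of_finrank_eq (h.trans hV.symm)
    refine hρ fun a => LinearMap.ext fun v => ?_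
    have hv : v ∈ ρ.invariants := htriv ▸ Submodule.mem_top
    exact hv a
  omega
end

section
/- The symmetric group on 5 letters, Perm(Fin 5), has exactly 19 conjugacy classes of subgroups; that is, the quotient of the set of subgroups of Perm(Fin 5) by the equivalence relation of conjugacy has cardinality 19. -/
namespace SubgroupsPermFinFive

open Equiv

/-- The base `5` number with digits `p 0, …, p 4`, least significant first. -/
def code (p : Perm (Fin 5)) : ℕ :=
  p 0 + 5 * p 1 + 25 * p 2 + 125 * p 3 + 625 * p 4

/-- The `k`-th base `5` digit of `c`. -/
def digit (c k : ℕ) : ℕ := c / 5 ^ k % 5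

/-- Composition of permutations, on codes. -/
def mulCode (a b : ℕ) : ℕ :=
  digit a (digit b 0) + 5 * digit a (digit b 1) + 25 * digit a (digit b 2) +
    125 * digit a (digit b 3) + 625 * digit a (digit b 4)

/-- Inversion of permutations, on codes. -/
def invCode (c : ℕ) : ℕ :=
  5 ^ digit c 1 + 2 * 5 ^ digit c 2 + 3 * 5 ^ digit c 3 + 4 * 5 ^ digit c 4

/-- Conjugation `x * a * x⁻¹`, on codes. -/
def conjCode (x a : ℕ) : ℕ := mulCode (mulCode x a) (invCode x)

/-- The code of the identity. -/
def oneCode : ℕ := 2930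

lemma digit_code (p : Perm (Fin 5)) (k : Fin 5) : digit (code p) k = p k := by
  have h0 := (p 0).isLt
  have h1 := (p 1).isLt
  have h2 := (p 2).isLt
  have h3 := (p 3).isLt
  have h4 := (p 4).isLt
  fin_cases k <;> simp [digit, code] <;> omega

lemma code_injective : Function.Injective code := fun p q h =>
  Equiv.ext fun k => Fin.ext (by rw [← digit_code, h, digit_code])

lemma code_one : code 1 = oneCode := rfl

lemma code_mul (p q : Perm (Fin 5)) : code (p * q) = mulCode (code p) (code q) := by
  have h (k : Fin 5) : digit (code p) (digit (code q) k) = (p * q) k := by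
    rw [digit_code, digit_code, Perm.mul_apply]
  have h0 := h 0
  have h1 := h 1
  have h2 := h 2
  have h3 := h 3
  have h4 := h 4
  simp only [Fin.coe_ofNat_eq_mod, Nat.reduceMod] at h0 h1 h2 h3 h4
  rw [mulCode, h0, h1, h2, h3, h4, code]

lemma code_inv (p : Perm (Fin 5)) : code p⁻¹ = invCode (code p) := by
  have h (q : Perm (Fin 5)) : code q = ∑ k : Fin 5, (q k : ℕ) * 5 ^ (k : ℕ) := by
    simp [code, Fin.sum_univ_five]; ring
  have hk (k : Fin 5) := digit_code p k
  have h1 := hk 1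
  have h2 := hk 2
  have h3 := hk 3
  have h4 := hk 4
  simp only [Fin.coe_ofNat_eq_mod, Nat.reduceMod] at h1 h2 h3 h4
  rw [h, ← Equiv.sum_comp p, invCode, h1, h2, h3, h4]
  simp [Fin.sum_univ_five]

lemma code_conj (x p : Perm (Fin 5)) :
    code (x * p * x⁻¹) = conjCode (code x) (code p) := by
  rw [conjCode, code_mul, code_mul, code_inv]

/-- The codes of all permutations. -/
def allCodes : List ℕ := (permsOfList (List.finRange 5)).map code

lemma mem_allCodes {c : ℕ} : c ∈ allCodes ↔ ∃ p, code p = c := by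
  have h (p : Perm (Fin 5)) : p ∈ permsOfList (List.finRange 5) :=
    mem_permsOfList_of_mem fun k _ => List.mem_finRange k
  simp [allCodes, h]

/-- Depth-first search: the bit mask of the codes reached from the list `q` by the moves `f`,
starting with the codes in the mask `m` already visited. The first argument bounds the number of
steps. -/
def dfs (f : ℕ → List ℕ) : ℕ → List ℕ → ℕ → ℕ
  | 0, _, m => m
  | _ + 1, [], m => m
  | n + 1, c :: q, m =>
    bif m.testBit c then dfs f n q m else dfs f n (f c ++ q) (m ||| 1 <<< c)

/-- Any property of codes that is preserved by the moves passes from the starting codes to all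
the codes reached. -/
lemma dfs_induction {f : ℕ → List ℕ} {P : ℕ → Prop} (hf : ∀ c, P c → ∀ d ∈ f c, P d) (n : ℕ) :
    ∀ (q : List ℕ) (m : ℕ), (∀ c ∈ q, P c) → (∀ c, m.testBit c → P c) →
      ∀ c, (dfs f n q m).testBit c → P c := by
  induction n with
  | zero => intro q m _ hm c hc; exact hm c (by simpa [dfs] using hc)
  | succ n ih =>
    rintro (_ | ⟨d, q⟩) m hq hm
    · simpa [dfs] using hm
    · rw [dfs]
      cases hd : m.testBit d
      · refine ih _ _ (fun c hc => ?_) (fun c hc => ?_)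
        · rcases List.mem_append.1 hc with hc | hc
          · exact hf d (hq d (by simp)) c hc
          · exact hq c (by simp [hc])
        · rw [Nat.testBit_or, Nat.one_shiftLeft, Nat.testBit_two_pow, Bool.or_eq_true,
            decide_eq_true_iff] at hc
          rcases hc with hc | rfl
          · exact hm c hc
          · exact hq _ (by simp)
      · exact ih _ _ (fun c hc => hq c (by simp [hc])) hm

/-- The mask of the codes of products of elements of `gens`. -/
def span (gens : List ℕ) : ℕ := dfs (fun c => gens.map (mulCode c)) 500 [oneCode] 0

lemma exists_of_testBit_span {gens : List ℕ} {H : Subgroup (Perm (Fin 5))}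
    (hg : ∀ c ∈ gens, ∃ p ∈ H, code p = c) {c : ℕ} (hc : (span gens).testBit c) :
    ∃ p ∈ H, code p = c := by
  refine dfs_induction (P := fun c => ∃ p ∈ H, code p = c) ?_ 500 _ _ ?_ ?_ c hc
  · rintro _ ⟨p, hp, rfl⟩ d hd
    obtain ⟨e, he, rfl⟩ := List.mem_map.1 hd
    obtain ⟨q, hq, rfl⟩ := hg e he
    exact ⟨p * q, mul_mem hp hq, code_mul p q⟩
  · intro c hc
    exact ⟨1, one_mem H, by rw [code_one, List.mem_singleton.1 hc]⟩
  · simp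

/-- A subgroup up to conjugacy, given by codes of permutations: two generators `fst` and `snd`,
some elements `norm` of its normalizer, and a list `seeds` of triples `(g, j, x)` such that the
subgroup and `g` together generate a subgroup that contains the conjugate by `x` of the `j`-th
subgroup of the list `data`. -/
structure Datum where
  fst : ℕ
  snd : ℕ
  norm : List ℕ
  seeds : List (ℕ × ℕ × ℕ)

instance : Inhabited Datum := ⟨⟨oneCode, oneCode, [], []⟩⟩

/-- The codes of the elements of the subgroup. -/
def Datum.mask (D : Datum) : ℕ := span [D.fst, D.snd]

/-- The subgroup given by a datum. -/
def Datum.subgroup (D : Datum) : Subgroup (Perm (Fin 5)) :=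
  Subgroup.closure {p | code p = D.fst ∨ code p = D.snd}

/-- Representatives of the conjugacy classes of subgroups, by increasing order. -/
def data : List Datum := [
  ⟨2930, 2930, [2430, 2586], [(2430, 1, 2930), (1830, 3, 2930), (2410, 2, 2930), (1210, 6,
    2930), (1826, 3, 2930), (586, 7, 2930)]⟩,
  ⟨2430, 2930, [2910, 2926], [(2830, 3, 2930), (2910, 2, 2930), (2710, 2, 2930), (1490, 2,
    2930), (2826, 3, 2930), (2886, 3, 1398), (2586, 2, 2930), (1366, 2, 2930)]⟩,
  ⟨2410, 2930, [2430, 1490], [(2430, 4, 2930), (2830, 5, 2930), (1830, 3, 2930), (1490, 5,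
    2930), (990, 6, 2830), (2926, 4, 2930), (2426, 3, 1398), (2826, 12, 2930), (1826, 3, 2930),
    (2586, 15, 2930), (586, 3, 2930), (1366, 3, 2930), (366, 3, 2930)]⟩,
  ⟨1830, 2930, [2430, 2926], [(2430, 8, 2930), (2910, 4, 2930), (2410, 5, 2930), (2926, 9,
    2930), (2426, 10, 2930), (2886, 5, 2930), (2386, 4, 2930), (2642, 5, 2930), (1142, 4,
    2930)]⟩,
  ⟨2430, 2910, [1490], [(2830, 5, 2930), (1490, 5, 2930), (2926, 8, 1398), (2826, 5, 2930),
    (2586, 5, 2930), (1366, 5, 2930)]⟩,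
  ⟨2410, 1490, [2430, 2830], [(2430, 11, 2930), (1830, 14, 2930), (2926, 6, 2930), (2426, 7,
    2930), (1826, 6, 2930)]⟩,
  ⟨1210, 2930, [1730], [(2430, 8, 2930), (1730, 11, 2830), (2926, 7, 2930), (2426, 7, 2230),
    (1826, 7, 2930), (1726, 7, 2930)]⟩,
  ⟨586, 2930, [2110], [(2430, 8, 2930), (1830, 10, 2930), (2110, 12, 2230), (1790, 12, 2230),
    (970, 12, 2230)]⟩,
  ⟨2430, 2830, [2926], [(2910, 11, 2930), (2926, 9, 2930), (2886, 9, 2930), (2642, 9, 2930)]⟩,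
  ⟨1826, 2930, [2430], [(2430, 10, 2930), (2910, 10, 2930), (2410, 10, 2930), (2642, 10, 2930)]⟩,
  ⟨1830, 2426, [2430], [(2430, 13, 2930), (2910, 11, 2930), (2410, 12, 2930), (2642, 12, 2930),
    (1142, 11, 2930)]⟩,
  ⟨2430, 1490, [], [(2830, 14, 2930), (2926, 12, 2930), (2826, 12, 2930)]⟩,
  ⟨2410, 2826, [990], [(2430, 13, 2930), (1830, 14, 2930), (990, 15, 2430)]⟩,
  ⟨2430, 2826, [], [(2910, 14, 2930), (2642, 14, 2930)]⟩,
  ⟨1830, 2710, [2430], [(2430, 16, 2930), (2926, 15, 2930), (2426, 17, 2930)]⟩,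
  ⟨2410, 2586, [], [(2430, 16, 2930)]⟩,
  ⟨2430, 2710, [], [(2926, 17, 2930)]⟩,
  ⟨1830, 2886, [2430], [(2430, 18, 2930)]⟩,
  ⟨2430, 2586, [], []⟩]

/-- The `i`-th representative. -/
def datum (i : ℕ) : Datum := data.getD i default

/-- Multiplication by the generators and conjugation by the given elements of the normalizer. -/
def Datum.moves (D : Datum) (c : ℕ) : List ℕ :=
  mulCode D.fst c :: mulCode c D.fst :: mulCode D.snd c :: mulCode c D.snd ::
    D.norm.map fun n => conjCode n c

/-- The codes obtained from the seeds by the moves. -/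
def Datum.reached (D : Datum) : ℕ := dfs D.moves 1000 (D.seeds.map Prod.fst) 0

/-- The generators are codes of permutations, and the mask is closed under multiplication
by them. -/
def Datum.checkGens (D : Datum) : Bool :=
  allCodes.contains D.fst && allCodes.contains D.snd && D.mask.testBit oneCode &&
    allCodes.all fun c => !D.mask.testBit c ||
      (D.mask.testBit (mulCode c D.fst) && D.mask.testBit (mulCode c D.snd))

/-- The given elements of the normalizer conjugate the generators into the subgroup. -/
def Datum.checkNorm (D : Datum) : Bool :=
  D.norm.all fun n => allCodes.contains n && D.mask.testBit (conjCode n D.fst) &&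
    D.mask.testBit (conjCode n D.snd)

/-- The seeds of the `i`-th datum lead to conjugates of subgroups later in the list. -/
def checkSeeds (i : ℕ) : Bool :=
  (datum i).seeds.all fun s =>
    allCodes.contains s.1 && allCodes.contains s.2.2 && Nat.blt i s.2.1 && Nat.blt s.2.1 19 &&
    (span [(datum i).fst, (datum i).snd, s.1]).testBit (conjCode s.2.2 (datum s.2.1).fst) &&
    (span [(datum i).fst, (datum i).snd, s.1]).testBit (conjCode s.2.2 (datum s.2.1).snd)

/-- Every permutation lies in the subgroup or is reached from a seed. -/
def Datum.checkCover (D : Datum) : Bool :=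
  allCodes.all fun c => D.mask.testBit c || D.reached.testBit c

lemma checkGens_eq_true : (List.range 19).all (fun i => (datum i).checkGens) = true := by
  decide +kernel

lemma checkNorm_eq_true : (List.range 19).all (fun i => (datum i).checkNorm) = true := by
  decide +kernel

lemma checkSeeds_eq_true : (List.range 19).all checkSeeds = true := by
  decide +kernel

lemma checkCover_eq_true : (List.range 19).all (fun i => (datum i).checkCover) = true := by
  decide +kernel

variable {D : Datum} {H : Subgroup (Perm (Fin 5))} {i : ℕ}

lemma exists_mem_subgroup_fst (h : D.checkGens = true) : ∃ p ∈ D.subgroup, code p = D.fst := by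
  simp only [Datum.checkGens, Bool.and_eq_true, List.contains_iff_mem] at h
  obtain ⟨p, hp⟩ := mem_allCodes.1 h.1.1.1
  exact ⟨p, Subgroup.subset_closure (Or.inl hp), hp⟩

lemma exists_mem_subgroup_snd (h : D.checkGens = true) : ∃ p ∈ D.subgroup, code p = D.snd := by
  simp only [Datum.checkGens, Bool.and_eq_true, List.contains_iff_mem] at h
  obtain ⟨p, hp⟩ := mem_allCodes.1 h.1.1.2
  exact ⟨p, Subgroup.subset_closure (Or.inr hp), hp⟩

lemma mem_subgroup_iff (h : D.checkGens = true) (p : Perm (Fin 5)) :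
    p ∈ D.subgroup ↔ D.mask.testBit (code p) := by
  constructor
  · have h' := h
    simp only [Datum.checkGens, Bool.and_eq_true, List.all_eq_true, Bool.or_eq_true,
      Bool.not_eq_true', ← Bool.not_eq_true] at h'
    have key (q r : Perm (Fin 5)) (hr : code r = D.fst ∨ code r = D.snd)
        (hq : D.mask.testBit (code q)) : D.mask.testBit (code (q * r)) := by
      obtain ⟨h₁, h₂⟩ := (h'.2 (code q) (mem_allCodes.2 ⟨q, rfl⟩)).resolve_left (· hq)
      rw [code_mul]
      rcases hr with hr | hr <;> rw [hr] <;> assumption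
    intro hp
    rw [Datum.subgroup, ← Subgroup.mem_toSubmonoid, Subgroup.closure_toSubmonoid_of_finite] at hp
    induction hp using Submonoid.closure_induction_right with
    | one => rw [code_one]; exact h'.1.2
    | mul_right q _ r hr hq => exact key q r hr hq
  · intro hp
    obtain ⟨q, hq, hqp⟩ := exists_of_testBit_span (H := D.subgroup) (gens := [D.fst, D.snd])
      (by simpa using ⟨exists_mem_subgroup_fst h, exists_mem_subgroup_snd h⟩) hp
    rwa [← code_injective hqp]

/-- The subgroup `K` is contained in `H` up to conjugacy. -/
def SubConj (K H : Subgroup (Perm (Fin 5))) : Prop :=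
  ∃ x, ∀ p ∈ K, x * p * x⁻¹ ∈ H

lemma subConj_subgroup {x : Perm (Fin 5)}
    (h : ∀ p, code p = D.fst ∨ code p = D.snd → x * p * x⁻¹ ∈ H) : SubConj D.subgroup H := by
  refine ⟨x, fun p hp => ?_⟩
  have : D.subgroup ≤ H.comap (MulAut.conj x).toMonoidHom :=
    (Subgroup.closure_le _).2 fun p hp => by simpa using h p hp
  simpa using this hp

/-- A code is `Good` for `i` if each subgroup containing both the `i`-th representative and the
permutation with this code contains a conjugate of a later representative. -/
def Good (i c : ℕ) : Prop :=
  ∃ p, code p = c ∧ ∀ H, (datum i).subgroup ≤ H → p ∈ H →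
    ∃ j, i < j ∧ j < 19 ∧ SubConj (datum j).subgroup H

lemma checkGens_datum (hi : i < 19) : (datum i).checkGens = true :=
  List.all_eq_true.1 checkGens_eq_true i (List.mem_range.2 hi)

lemma good_of_mem_seeds (hi : i < 19) {s : ℕ × ℕ × ℕ} (hs : s ∈ (datum i).seeds) :
    Good i s.1 := by
  have h := List.all_eq_true.1 (List.all_eq_true.1 checkSeeds_eq_true i (List.mem_range.2 hi)) s hs
  simp only [Bool.and_eq_true, List.contains_iff_mem, Nat.blt_eq, mem_allCodes] at h
  obtain ⟨⟨⟨⟨⟨⟨p, hp⟩, x, hx⟩, hij⟩, hj⟩, h₁⟩, h₂⟩ := h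
  refine ⟨p, hp, fun H hH hpH => ⟨s.2.1, hij, hj, subConj_subgroup (x := x) fun q hq => ?_⟩⟩
  have hg : ∀ c ∈ [(datum i).fst, (datum i).snd, s.1], ∃ p ∈ H, code p = c := by
    obtain ⟨a, ha, ha'⟩ := exists_mem_subgroup_fst (checkGens_datum hi)
    obtain ⟨b, hb, hb'⟩ := exists_mem_subgroup_snd (checkGens_datum hi)
    simpa using ⟨⟨a, hH ha, ha'⟩, ⟨b, hH hb, hb'⟩, ⟨p, hpH, hp⟩⟩
  have key : ∃ r ∈ H, code r = conjCode s.2.2 (code q) := by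
    rcases hq with hq | hq <;> rw [hq]
    exacts [exists_of_testBit_span hg h₁, exists_of_testBit_span hg h₂]
  obtain ⟨r, hr, hrq⟩ := key
  rw [← hx, ← code_conj] at hrq
  rwa [← code_injective hrq]

lemma good_of_mem_moves (hi : i < 19) {c d : ℕ} (hc : Good i c) (hd : d ∈ (datum i).moves c) :
    Good i d := by
  obtain ⟨p, rfl, hp⟩ := hc
  obtain ⟨a, ha, ha'⟩ := exists_mem_subgroup_fst (checkGens_datum hi)
  obtain ⟨b, hb, hb'⟩ := exists_mem_subgroup_snd (checkGens_datum hi)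
  simp only [Datum.moves, List.mem_cons, List.mem_map, ← ha', ← hb', ← code_mul] at hd
  rcases hd with rfl | rfl | rfl | rfl | ⟨n, hn, rfl⟩
  · exact ⟨_, rfl, fun H hH h => hp H hH ((H.mul_mem_cancel_left (hH ha)).1 h)⟩
  · exact ⟨_, rfl, fun H hH h => hp H hH ((H.mul_mem_cancel_right (hH ha)).1 h)⟩
  · exact ⟨_, rfl, fun H hH h => hp H hH ((H.mul_mem_cancel_left (hH hb)).1 h)⟩
  · exact ⟨_, rfl, fun H hH h => hp H hH ((H.mul_mem_cancel_right (hH hb)).1 h)⟩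
  · have h := List.all_eq_true.1
      (List.all_eq_true.1 checkNorm_eq_true i (List.mem_range.2 hi)) n hn
    simp only [Bool.and_eq_true, List.contains_iff_mem, mem_allCodes] at h
    obtain ⟨⟨⟨x, rfl⟩, h₁⟩, h₂⟩ := h
    refine ⟨_, code_conj x p, fun H hH hxp => ?_⟩
    have hle : (datum i).subgroup ≤ H.comap (MulAut.conj x).toMonoidHom := by
      refine (Subgroup.closure_le _).2 fun q hq => ?_
      have : x * q * x⁻¹ ∈ (datum i).subgroup := by
        rw [mem_subgroup_iff (checkGens_datum hi), code_conj]
        rcases hq with hq | hq <;> rw [hq] <;> assumption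
      simpa using hH this
    obtain ⟨j, hij, hj, y, hy⟩ := hp _ hle (by simpa using hxp)
    exact ⟨j, hij, hj, x * y, fun q hq => by simpa [mul_assoc] using hy q hq⟩

lemma mem_subgroup_or_good (hi : i < 19) (p : Perm (Fin 5)) :
    p ∈ (datum i).subgroup ∨ Good i (code p) := by
  have h := List.all_eq_true.1 (List.all_eq_true.1 checkCover_eq_true i (List.mem_range.2 hi))
    (code p) (mem_allCodes.2 ⟨p, rfl⟩)
  rw [Bool.or_eq_true, ← mem_subgroup_iff (checkGens_datum hi)] at h
  refine h.imp_right fun h => ?_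
  refine dfs_induction (P := Good i) (fun c hc d hd => good_of_mem_moves hi hc hd) _ _ _ ?_ ?_ _ h
  · simp only [List.mem_map]
    rintro _ ⟨s, hs, rfl⟩
    exact good_of_mem_seeds hi hs
  · simp

lemma exists_map_conj_eq {i : ℕ} (hi : i < 19) (h : SubConj (datum i).subgroup H) :
    ∃ j < 19, ∃ x, (datum j).subgroup.map (MulAut.conj x).toMonoidHom = H := by
  obtain ⟨x, hx⟩ := h
  by_cases hH : ∀ p, x * p * x⁻¹ ∈ H → p ∈ (datum i).subgroup
  · refine ⟨i, hi, x, Subgroup.ext fun p => ?_⟩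
    rw [Subgroup.mem_map]
    constructor
    · rintro ⟨q, hq, rfl⟩
      exact hx q hq
    · intro hp
      have hxp : x * (x⁻¹ * p * x) * x⁻¹ = p := by group
      exact ⟨x⁻¹ * p * x, hH _ (by rwa [hxp]), hxp⟩
  · push Not at hH
    obtain ⟨p, hp, hpi⟩ := hH
    obtain ⟨q, hq, hgood⟩ := (mem_subgroup_or_good hi p).resolve_left hpi
    rw [code_injective hq] at hgood
    obtain ⟨j, hij, hj, y, hy⟩ := hgood (H.comap (MulAut.conj x).toMonoidHom)
      (fun r hr => by simpa using hx r hr) (by simpa using hp)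
    exact exists_map_conj_eq hj ⟨x * y, fun r hr => by simpa [mul_assoc] using hy r hr⟩
termination_by 19 - i

/-- A class function that distinguishes the conjugacy classes of subgroups when summed. -/
def weight (p : Perm (Fin 5)) : ℕ :=
  (1 + ∑ k, if p k = k then 1 else 0) * (1 + ∑ k, if (p * p) k = k then 1 else 0)

/-- The number of fixed points, on codes. -/
def fixCode (c : ℕ) : ℕ :=
  (bif Nat.beq (digit c 0) 0 then 1 else 0) + (bif Nat.beq (digit c 1) 1 then 1 else 0) +
    (bif Nat.beq (digit c 2) 2 then 1 else 0) + (bif Nat.beq (digit c 3) 3 then 1 else 0) +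
    (bif Nat.beq (digit c 4) 4 then 1 else 0)

/-- The function `weight`, on codes. -/
def weightCode (c : ℕ) : ℕ := (1 + fixCode c) * (1 + fixCode (mulCode c c))

lemma weight_eq (p : Perm (Fin 5)) : weight p = weightCode (code p) := by
  have h (q : Perm (Fin 5)) : ∑ k, (if q k = k then 1 else 0) = fixCode (code q) := by
    have hk (k : Fin 5) : (if q k = k then 1 else 0) =
        bif Nat.beq (digit (code q) k) k then 1 else 0 := by
      simp [digit_code, Bool.cond_eq_ite, Fin.val_inj]
    simp_rw [hk, Fin.sum_univ_five]
    rfl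
  rw [weight, h, h, code_mul, weightCode]

lemma weight_conj (x p : Perm (Fin 5)) : weight (x * p * x⁻¹) = weight p := by
  have h (q : Perm (Fin 5)) : ∑ k, (if (x * q * x⁻¹) k = k then 1 else 0) =
      ∑ k, if q k = k then 1 else 0 := by
    rw [← Equiv.sum_comp x]
    simp
  have hsq : x * p * x⁻¹ * (x * p * x⁻¹) = x * (p * p) * x⁻¹ := by group
  rw [weight, hsq, h, h, weight]

open Classical in
/-- The sum of the weights of the elements of a subgroup. -/
noncomputable def totalWeight (H : Subgroup (Perm (Fin 5))) : ℕ :=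
  ∑ p, if p ∈ H then weight p else 0

open Classical in
lemma totalWeight_map (x : Perm (Fin 5)) (H : Subgroup (Perm (Fin 5))) :
    totalWeight (H.map (MulAut.conj x).toMonoidHom) = totalWeight H := by
  rw [totalWeight, ← Equiv.sum_comp (MulAut.conj x).toEquiv]
  refine Finset.sum_congr rfl fun p _ => ?_
  have : x * p * x⁻¹ ∈ H.map (MulAut.conj x).toMonoidHom ↔ p ∈ H :=
    Subgroup.mem_map_iff_mem (MulAut.conj x).injective
  exact if_congr this (weight_conj x p) rfl

/-- The total weight of the subgroup given by a datum. -/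
def Datum.totalWeight (D : Datum) : ℕ :=
  (allCodes.map fun c => bif D.mask.testBit c then weightCode c else 0).sum

lemma totalWeight_subgroup (h : D.checkGens = true) :
    totalWeight D.subgroup = D.totalWeight := by
  have huniv : (Finset.univ : Finset (Perm (Fin 5))) =
      (permsOfList (List.finRange 5)).toFinset := by
    ext p
    simpa using mem_permsOfList_of_mem fun k _ => List.mem_finRange k
  rw [SubgroupsPermFinFive.totalWeight, huniv,
    List.sum_toFinset _ (nodup_permsOfList (List.nodup_finRange 5)), Datum.totalWeight, allCodes,
    List.map_map]
  refine congrArg List.sum (List.map_congr_left fun p _ => ?_)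
  simp [mem_subgroup_iff h, weight_eq, Bool.cond_eq_ite]

/-- The total weights of the representatives. -/
def totalWeights : List ℕ :=
  [36, 60, 48, 54, 96, 72, 56, 40, 126, 84, 90, 128, 100, 192, 144, 140, 312, 420, 840]

lemma map_totalWeight : (List.range 19).map (fun i => (datum i).totalWeight) = totalWeights := by
  decide +kernel

lemma totalWeight_datum (hi : i < 19) :
    totalWeight (datum i).subgroup = totalWeights.getD i 0 := by
  rw [totalWeight_subgroup (checkGens_datum hi), ← map_totalWeight]
  simp [hi]

lemma totalWeights_injective :
    ∀ i j : Fin 19, totalWeights.getD i 0 = totalWeights.getD j 0 → i = j := by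
  decide

end SubgroupsPermFinFive

/-- `Perm (Fin 5)` has exactly 19 conjugacy classes of subgroups: the
quotient of the set of its subgroups by the relation of conjugacy has cardinality 19. -/
theorem stmt9 :
    Nat.card (Quot fun H K : Subgroup (Equiv.Perm (Fin 5)) =>
      ∃ g : Equiv.Perm (Fin 5), Subgroup.map (MulAut.conj g).toMonoidHom H = K) = 19 := by
  open SubgroupsPermFinFive in
  rw [← Nat.card_fin 19]
  refine (Nat.card_eq_of_bijective (fun i : Fin 19 => Quot.mk _ (datum i).subgroup) ⟨?_, ?_⟩).symm
  · intro i j hij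
    have h := congrArg (Quot.lift totalWeight
      fun H K ⟨x, hx⟩ => by rw [← hx, totalWeight_map]) hij
    refine totalWeights_injective i j ?_
    rw [← totalWeight_datum i.isLt, ← totalWeight_datum j.isLt]
    exact h
  · rintro ⟨H⟩
    have h0 : SubConj (datum 0).subgroup H := by
      refine subConj_subgroup (x := 1) fun p hp => ?_
      have : p = 1 := code_injective (by rcases hp with hp | hp <;> exact hp)
      simp [this]
    obtain ⟨j, hj, x, hx⟩ := exists_map_conj_eq (by norm_num) h0
    exact ⟨⟨j, hj⟩, Quot.sound ⟨x, hx⟩⟩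
end
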